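/- Let P be a continuous poset, A ⊆ P and x ∈ P. Then x belongs to the Scott closure of A if and only if ↡x ⊆ ↓A, i.e., every element way below x lies below some element of A. -/

import Mathlib

namespace RoughDomain

variable {P : Type*}

/-- `sRel r x` is the set `s_≺(x) = {y | y ≺ x}`. -/
def sRel [PartialOrder P] (r : P → P → Prop) (x : P) : Set P := {y | r y x}

/-- An auxiliary relation on a poset. -/
def IsAux [PartialOrder P] (r : P → P → Prop) : Prop :=
  (∀ x y, r x y → x ≤ y) ∧
  (∀ u x y z, u ≤ x → r x y → y ≤ z → r u z) ∧
  (∀ b : P, (∀ p, b ≤ p) → ∀ x, r b x)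

/-- The downward closure `↓A`. -/
def dcl [PartialOrder P] (A : Set P) : Set P := {z | ∃ a ∈ A, z ≤ a}

/-- Lower approximation `A^{↓≺} = {x ∈ A | s_≺(x) ∩ A ≠ ∅}`. -/
def lap [PartialOrder P] (r : P → P → Prop) (A : Set P) : Set P :=
  {x | x ∈ A ∧ (sRel r x ∩ A).Nonempty}

/-- Upper approximation `A^{↑≺} = {x | s_≺(x) ⊆ ↓A}`. -/
def uap [PartialOrder P] (r : P → P → Prop) (A : Set P) : Set P :=
  {x | sRel r x ⊆ dcl A}

/-- A directed subset of a poset (nonempty and upward directed). -/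
def IsDir [PartialOrder P] (D : Set P) : Prop :=
  D.Nonempty ∧ DirectedOn (· ≤ ·) D

/-- A pre-approximating auxiliary relation: each `s_≺(x)` is directed. -/
def IsPreApprox [PartialOrder P] (r : P → P → Prop) : Prop :=
  IsAux r ∧ ∀ x, IsDir (sRel r x)

/-- An approximating auxiliary relation: moreover `x = ⋁ s_≺(x)`. -/
def IsApprox [PartialOrder P] (r : P → P → Prop) : Prop :=
  IsPreApprox r ∧ ∀ x, IsLUB (sRel r x) x

/-- The way-below relation `x ≪ y`. -/
def wb [PartialOrder P] (x y : P) : Prop :=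
  ∀ D : Set P, IsDir D → ∀ a, IsLUB D a → y ≤ a → ∃ d ∈ D, x ≤ d

/-- A continuous poset: each `↡x` is directed with supremum `x`. -/
def IsContinuousPoset (P : Type*) [PartialOrder P] : Prop :=
  ∀ x : P, IsDir {y | wb y x} ∧ IsLUB {y | wb y x} x

/-- Scott open sets: upper sets inaccessible by existing directed suprema. -/
def ScottOpen [PartialOrder P] (U : Set P) : Prop :=
  IsUpperSet U ∧
    ∀ D : Set P, IsDir D → ∀ a, IsLUB D a → a ∈ U → (D ∩ U).Nonempty

/-- The Scott topology on a poset. -/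
def scottTop (P : Type*) [PartialOrder P] : TopologicalSpace P where
  IsOpen := ScottOpen
  isOpen_univ :=
    ⟨isUpperSet_univ, fun _D hD _a _ _ => hD.1.imp fun d hd => ⟨hd, trivial⟩⟩
  isOpen_inter := by
    rintro U V ⟨hU1, hU2⟩ ⟨hV1, hV2⟩
    refine ⟨hU1.inter hV1, fun D hD a ha haUV => ?_⟩
    obtain ⟨d1, hd1D, hd1U⟩ := hU2 D hD a ha haUV.1
    obtain ⟨d2, hd2D, hd2V⟩ := hV2 D hD a ha haUV.2
    obtain ⟨d, hdD, h1, h2⟩ := hD.2 d1 hd1D d2 hd2D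
    exact ⟨d, hdD, hU1 h1 hd1U, hV1 h2 hd2V⟩
  isOpen_sUnion := by
    intro S hS
    constructor
    · intro a b hab ha
      obtain ⟨U, hUS, haU⟩ := ha
      exact ⟨U, hUS, (hS U hUS).1 hab haU⟩
    · intro D hD a ha haU
      obtain ⟨U, hUS, haU⟩ := haU
      obtain ⟨d, hdD, hdU⟩ := (hS U hUS).2 D hD a ha haU
      exact ⟨d, hdD, U, hUS, hdU⟩

lemma lap_subset [PartialOrder P] (r : P → P → Prop) (A : Set P) :
    lap r A ⊆ A := fun _x hx => hx.1

/-- `≺`-open sets: upper sets `U` with `U = U^{↓≺}`. -/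
def PrecOpen [PartialOrder P] (r : P → P → Prop) (U : Set P) : Prop :=
  IsUpperSet U ∧ lap r U = U

/-- The topology `μ^≺(P)` of `≺`-open sets, for `≺` pre-approximating. -/
def muTop [PartialOrder P] (r : P → P → Prop) (h : IsPreApprox r) :
    TopologicalSpace P where
  IsOpen := PrecOpen r
  isOpen_univ := by
    refine ⟨isUpperSet_univ,
      Set.Subset.antisymm (lap_subset r _) fun x _ => ⟨trivial, ?_⟩⟩
    obtain ⟨y, hy⟩ := (h.2 x).1
    exact ⟨y, hy, trivial⟩
  isOpen_inter := by
    rintro U V ⟨hU1, hU2⟩ ⟨hV1, hV2⟩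
    refine ⟨hU1.inter hV1,
      Set.Subset.antisymm (lap_subset r _) fun x hx => ?_⟩
    have h1 : x ∈ lap r U := by rw [hU2]; exact hx.1
    have h2 : x ∈ lap r V := by rw [hV2]; exact hx.2
    obtain ⟨y1, hy1r, hy1U⟩ := h1.2
    obtain ⟨y2, hy2r, hy2V⟩ := h2.2
    obtain ⟨y, hyr, hle1, hle2⟩ := (h.2 x).2 y1 hy1r y2 hy2r
    exact ⟨hx, y, hyr, hU1 hle1 hy1U, hV1 hle2 hy2V⟩
  isOpen_sUnion := by
    intro S hS
    constructor
    · intro a b hab ha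
      obtain ⟨U, hUS, haU⟩ := ha
      exact ⟨U, hUS, (hS U hUS).1 hab haU⟩
    · refine Set.Subset.antisymm (lap_subset r _) fun x hx => ?_
      obtain ⟨U, hUS, hxU⟩ := hx
      have h1 : x ∈ lap r U := by rw [(hS U hUS).2]; exact hxU
      obtain ⟨y, hyr, hyU⟩ := h1.2
      exact ⟨⟨U, hUS, hxU⟩, y, hyr, U, hUS, hyU⟩

/-- A c-space: every point of an open set is in the interior of `↑y`
(with respect to the specialization preorder) for some `y` in that open set. -/
def IsCSpace (X : Type*) [TopologicalSpace X] : Prop :=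
  ∀ x : X, ∀ U : Set X, IsOpen U → x ∈ U →
    ∃ y ∈ U, x ∈ interior {z | ∀ V : Set X, IsOpen V → y ∈ V → z ∈ V}

/-- Complete distributivity of a complete lattice. -/
def CompletelyDistrib (L : Type*) [CompleteLattice L] : Prop :=
  ∀ {ι : Type*} {κ : ι → Type*} (f : ∀ i : ι, κ i → L),
    ⨅ i, ⨆ j, f i j = ⨆ g : ∀ i, κ i, ⨅ i, f i (g i)

/-- `A' `: the set of suprema of directed subsets of `↓A`. -/
def oneStep [PartialOrder P] (A : Set P) : Set P :=
  {x | ∃ D : Set P, IsDir D ∧ D ⊆ dcl A ∧ IsLUB D x}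

lemma wb_le [PartialOrder P] {x y : P} (h : wb x y) : x ≤ y := by
  obtain ⟨d, hd, hxd⟩ := h {y} ⟨⟨y, rfl⟩, directedOn_singleton y⟩ y
    isLUB_singleton le_rfl
  exact hxd.trans (le_of_eq hd)

lemma wb_mono [PartialOrder P] {u x y z : P} (h1 : u ≤ x) (h : wb x y) (h2 : y ≤ z) :
    wb u z := by
  intro D hD a ha hza
  obtain ⟨d, hd, hxd⟩ := h D hD a ha (h2.trans hza)
  exact ⟨d, hd, h1.trans hxd⟩

lemma wb_interp [PartialOrder P] (hP : IsContinuousPoset P) {y z : P} (h : wb y z) :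
    ∃ w, wb y w ∧ wb w z := by
  have hdir : IsDir {u : P | ∃ w, wb u w ∧ wb w z} := by
    constructor
    · obtain ⟨w, hw⟩ := (hP z).1.1
      obtain ⟨u, hu⟩ := (hP w).1.1
      exact ⟨u, w, hu, hw⟩
    · rintro u1 ⟨w1, hu1, hw1⟩ u2 ⟨w2, hu2, hw2⟩
      obtain ⟨w, hw, h1, h2⟩ := (hP z).1.2 w1 hw1 w2 hw2
      obtain ⟨u, hu, h3, h4⟩ := (hP w).1.2 u1 (wb_mono le_rfl hu1 h1) u2
        (wb_mono le_rfl hu2 h2)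
      exact ⟨u, ⟨w, hu, hw⟩, h3, h4⟩
  have hlub : IsLUB {u : P | ∃ w, wb u w ∧ wb w z} z := by
    constructor
    · rintro u ⟨w, hu, hw⟩
      exact (wb_le hu).trans (wb_le hw)
    · intro b hb
      refine (hP z).2.2 fun w hw => (hP w).2.2 fun u hu => hb ⟨w, hu, hw⟩
  obtain ⟨d, ⟨w, hdw, hw⟩, hyd⟩ := h _ hdir z hlub le_rfl
  exact ⟨w, wb_mono hyd hdw le_rfl, hw⟩

lemma scottOpen_wb [PartialOrder P] (hP : IsContinuousPoset P) (y : P) :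
    ScottOpen {z | wb y z} := by
  refine ⟨fun a b hab ha => wb_mono le_rfl ha hab, fun D hD a ha hya => ?_⟩
  obtain ⟨w, hyw, hwa⟩ := wb_interp hP hya
  obtain ⟨d, hd, hwd⟩ := hwa D hD a ha le_rfl
  exact ⟨d, hd, wb_mono le_rfl hyw hwd⟩

theorem stmt12 [PartialOrder P] (hP : IsContinuousPoset P) (A : Set P) (x : P) :
    x ∈ @closure P (scottTop P) A ↔ {y | wb y x} ⊆ dcl A := by
  rw [@mem_closure_iff P (scottTop P)]
  constructor
  · intro h y hy
    obtain ⟨a, hya, haA⟩ := h {z | wb y z} (scottOpen_wb hP y) hy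
    exact ⟨a, haA, wb_le hya⟩
  · intro h U hU hxU
    have hU' : ScottOpen U := hU
    obtain ⟨y, hy, hyU⟩ := hU'.2 _ (hP x).1 x (hP x).2 hxU
    obtain ⟨a, ha, hya⟩ := h hy
    exact ⟨a, hU'.1 hya hyU, ha⟩

end RoughDomain
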